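/- arXiv:2506.05893 — 7 statements merged into one kernel-verified Lean document; each statement's English description precedes it below -/
import Mathlib

section
/- Let A > 0, ρ > 0, U ≥ 0 be real constants and let n ≥ 2 be an even natural number. Let a : ℝ → ℝ be differentiable and u : ℝ → ℝ satisfy |u(t)| ≤ U for all t ≥ 0. Suppose a satisfies the input saturation model a'(t) = (1 - (a(t)/A)^n)·u(t) - ρ·a(t) for all t ≥ 0, and |a(0)| < A. Then |a(t)| < A for all t ≥ 0. -/
/-- A differentiable function that starts below the level `c` and whose derivative is negative
whenever it reaches `c` stays strictly below `c`. -/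
lemma lt_of_deriv_neg_at_level {f : ℝ → ℝ} {c : ℝ} (hf : Differentiable ℝ f) (h0 : f 0 < c)
    (hc : ∀ t ≥ 0, f t = c → deriv f t < 0) : ∀ t ≥ 0, f t < c := by
  have hle : ∀ t ≥ 0, f t ≤ c := fun t ht ↦
    image_le_of_deriv_right_lt_deriv_boundary (a := 0) (b := t) (f' := deriv f)
      (B := fun _ ↦ c) (B' := fun _ ↦ 0) hf.continuous.continuousOn
      (fun x _ ↦ (hf x).hasDerivAt.hasDerivWithinAt) h0.le (fun x ↦ hasDerivAt_const x c)
      (fun x hx hfx ↦ hc x hx.1 hfx) ⟨ht, le_rfl⟩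
  intro t ht
  refine (hle t ht).lt_of_ne fun hft ↦ ?_
  have htpos : 0 < t := ht.lt_of_ne (by rintro rfl; exact h0.ne hft)
  have hmax : IsLocalMax f t := by
    filter_upwards [lt_mem_nhds htpos] with s hs
    exact (hle s hs.le).trans_eq hft.symm
  exact (hc t ht hft).ne hmax.deriv_eq_zero

/-- Input saturation model keeps the lateral acceleration strictly inside the bound:
if `a' t = (1 - (a t / A)^n) * u t - ρ * a t` for all `t ≥ 0`, with `|u t| ≤ U`,
`n ≥ 2` even, and `|a 0| < A`, then `|a t| < A` for all `t ≥ 0`. -/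
theorem input_saturation_model_bound
    (A ρ U : ℝ) (hA : 0 < A) (hρ : 0 < ρ) (hU : 0 ≤ U)
    (n : ℕ) (hn2 : 2 ≤ n) (hneven : Even n)
    (a u : ℝ → ℝ) (ha : Differentiable ℝ a)
    (hu : ∀ t ≥ (0:ℝ), |u t| ≤ U)
    (hode : ∀ t ≥ (0:ℝ), deriv a t = (1 - (a t / A) ^ n) * u t - ρ * a t)
    (h0 : |a 0| < A) :
    ∀ t ≥ (0:ℝ), |a t| < A := by
  have hsq : ∀ t ≥ (0 : ℝ), (a ^ 2) t < A ^ 2 := by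
    refine lt_of_deriv_neg_at_level (ha.pow 2) (sq_lt_sq.2 (by rwa [abs_of_pos hA])) ?_
    intro t ht hat
    have hat' : a t ^ 2 = A ^ 2 := hat
    have hpow : (a t / A) ^ n = 1 := by
      obtain ⟨k, rfl⟩ := hneven
      rw [← two_mul, pow_mul, div_pow, hat', div_self (by positivity), one_pow]
    have hderiv : deriv (a ^ 2) t = -(2 * ρ * A ^ 2) := by
      rw [((ha t).hasDerivAt.pow 2).deriv, hode t ht, hpow, ← hat']
      norm_num
      ring
    rw [hderiv]
    exact neg_neg_of_pos (by positivity)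
  intro t ht
  exact abs_lt_of_sq_lt_sq (hsq t ht) hA.le
end

section
/- Let U > 0, ρ > 0, A > 0 be real numbers and n ≥ 1 a natural number, and set δ := A·(U/(U + ρ·A))^(1/n) (real power). Then (i) δ < A, and (ii) for every real a with δ ≤ a ≤ A, one has U·(1 - (a/A)^n) - ρ·a ≤ 0. -/
/-- The threshold `δ = A·(U/(U+ρA))^(1/n)` is strictly below `A`, and above it the
right-hand-side bound `U·(1 - (a/A)^n) - ρ·a` is nonpositive. -/
theorem saturation_threshold
    (U ρ A : ℝ) (hU : 0 < U) (hρ : 0 < ρ) (hA : 0 < A)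
    (n : ℕ) (hn : 1 ≤ n)
    (δ : ℝ) (hδ : δ = A * (U / (U + ρ * A)) ^ ((1:ℝ) / n)) :
    δ < A ∧ ∀ a : ℝ, δ ≤ a → a ≤ A → U * (1 - (a / A) ^ n) - ρ * a ≤ 0 := by
  have hn0 : n ≠ 0 := by omega
  have hρA : 0 < ρ * A := mul_pos hρ hA
  have hq : 0 < U / (U + ρ * A) := by positivity
  have hq1 : U / (U + ρ * A) < 1 := by
    rw [div_lt_one (by positivity)]
    linarith
  subst hδ
  refine ⟨?_, fun a ha haA => ?_⟩
  · have h := Real.rpow_lt_one hq.le hq1 (by positivity : (0 : ℝ) < 1 / n)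
    exact mul_lt_of_lt_one_right hA h
  · have hroot : (U / (U + ρ * A)) ^ ((1 : ℝ) / n) ≤ a / A := by
      rw [le_div_iff₀ hA]
      linarith
    have hx0 : 0 ≤ a / A := (Real.rpow_nonneg hq.le _).trans hroot
    have hx1 : a / A ≤ 1 := (div_le_one hA).2 haA
    have hpow : U / (U + ρ * A) ≤ (a / A) ^ n := by
      have h := pow_le_pow_left₀ (Real.rpow_nonneg hq.le _) hroot n
      rwa [one_div, Real.rpow_inv_natCast_pow hq.le hn0] at h
    have hpow_le : (a / A) ^ n ≤ a / A := pow_le_of_le_one hx0 hx1 hn0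
    have hU_le : U ≤ (a / A) ^ n * (U + ρ * A) := (div_le_iff₀ (by positivity)).1 hpow
    have hρa : ρ * A * (a / A) = ρ * a := by field_simp
    have hmul := mul_le_mul_of_nonneg_left hpow_le hρA.le
    linarith
end

section
/- Let k_a, k_b > 0 and let I = (-k_a, k_b) ⊂ ℝ be the open interval. Let V₁ : ℝ → ℝ be continuous on I with V₁(x) → +∞ as x → -k_a from the right and as x → k_b from the left (limits within I). Let z : ℝ → ℝ be continuous with z(0) ∈ I, and suppose that for every T ≥ 0 such that z(s) ∈ I for all s ∈ [0, T], one has V₁(z(T)) ≤ V₁(z(0)). Then z(t) ∈ I for all t ≥ 0. -/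
/-- A continuous trajectory starting in an open set `U` never leaves `U` if a function that blows
up at the frontier of `U` stays below its initial value as long as the trajectory is in `U`. -/
theorem IsOpen.mem_of_barrier {X : Type*} [TopologicalSpace X] {U : Set X} (hU : IsOpen U)
    {V : X → ℝ} (hV : ∀ x ∈ frontier U, Filter.Tendsto V (nhdsWithin x U) Filter.atTop)
    {z : ℝ → X} (hz : Continuous z) (hz0 : z 0 ∈ U)
    (hdecay : ∀ T ≥ (0:ℝ), (∀ s ∈ Set.Icc (0:ℝ) T, z s ∈ U) → V (z T) ≤ V (z 0))
    {t : ℝ} (ht : 0 ≤ t) : z t ∈ U := by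
  by_contra hzt
  -- `τ` is the first exit time.
  obtain ⟨τ, ⟨hτ0, hτU⟩, hτ⟩ : ∃ τ, IsLeast (Set.Ici (0:ℝ) ∩ z ⁻¹' Uᶜ) τ :=
    ⟨_, (isClosed_Ici.inter (hU.isClosed_compl.preimage hz)).isLeast_csInf
      ⟨t, ht, hzt⟩ ⟨0, fun _ hs => hs.1⟩⟩
  have hτpos : 0 < τ := lt_of_le_of_ne hτ0 (by rintro rfl; exact hτU hz0)
  have hmem : ∀ s, 0 ≤ s → s < τ → z s ∈ U := fun s hs hsτ => by
    by_contra hsU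
    exact hsτ.not_ge (hτ ⟨hs, hsU⟩)
  have hev : ∀ᶠ s in nhdsWithin τ (Set.Iio τ), 0 ≤ s ∧ s < τ := by
    filter_upwards [Ioo_mem_nhdsLT hτpos] with s hs using ⟨hs.1.le, hs.2⟩
  have hlim : Filter.Tendsto z (nhdsWithin τ (Set.Iio τ)) (nhdsWithin (z τ) U) :=
    tendsto_nhdsWithin_iff.2 ⟨hz.continuousWithinAt, hev.mono fun s hs => hmem s hs.1 hs.2⟩
  have hfrontier : z τ ∈ frontier U := by
    rw [hU.frontier_eq]
    exact ⟨mem_closure_iff_nhdsWithin_neBot.2 (hlim.neBot), hτU⟩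
  obtain ⟨s, hs, hVs⟩ :=
    (hev.and (((hV _ hfrontier).comp hlim).eventually_gt_atTop (V (z 0)))).exists
  exact hVs.not_ge (hdecay s hs.1 fun r hr => hmem r hr.1 (hr.2.trans_lt hs.2))

/-- Barrier invariance principle: if a barrier function `V₁` blows up at the endpoints
of the open interval `I = (-k_a, k_b)` and does not increase along the continuous
trajectory `z` while `z` stays in `I`, and `z 0 ∈ I`, then `z t ∈ I` for all `t ≥ 0`. -/
theorem barrier_invariance
    (k_a k_b : ℝ) (hka : 0 < k_a) (hkb : 0 < k_b)
    (V₁ : ℝ → ℝ)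
    (hV₁cont : ContinuousOn V₁ (Set.Ioo (-k_a) k_b))
    (hV₁left : Filter.Tendsto V₁ (nhdsWithin (-k_a) (Set.Ioo (-k_a) k_b)) Filter.atTop)
    (hV₁right : Filter.Tendsto V₁ (nhdsWithin k_b (Set.Ioo (-k_a) k_b)) Filter.atTop)
    (z : ℝ → ℝ) (hz : Continuous z) (hz0 : z 0 ∈ Set.Ioo (-k_a) k_b)
    (hdecay : ∀ T ≥ (0:ℝ), (∀ s ∈ Set.Icc (0:ℝ) T, z s ∈ Set.Ioo (-k_a) k_b) →
      V₁ (z T) ≤ V₁ (z 0)) :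
    ∀ t ≥ (0:ℝ), z t ∈ Set.Ioo (-k_a) k_b := by
  intro t ht
  refine isOpen_Ioo.mem_of_barrier (fun x hx => ?_) hz hz0 hdecay ht
  rw [frontier_Ioo (by linarith)] at hx
  rcases hx with rfl | rfl
  · exact hV₁left
  · exact hV₁right
end

section
/- Let V > 0, r > 0, and κ > 2 be real numbers, and let σ be a real number with 0 < |σ| < π/2. Then σ · ( -(V·κ/(r·sin(2σ))) · (1 - cos σ·(1 + sin²σ/κ)) ) < 0. -/
open Real

/-- The bracket of the lead-angle dynamics, with `c` for `cos σ`, is positive. -/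
lemma one_sub_mul_one_add_div_pos {c κ : ℝ} (hc0 : 0 < c) (hc1 : c < 1) (hκ : 2 < κ) :
    0 < 1 - c * (1 + (1 - c ^ 2) / κ) := by
  have hc2 : 0 < 1 - c ^ 2 := by nlinarith
  have hdiv : (1 - c ^ 2) / κ < (1 - c ^ 2) / 2 :=
    div_lt_div_of_pos_left hc2 two_pos hκ
  have hfac : 0 < (1 - c) * (1 - c * (1 + c) / 2) :=
    mul_pos (by linarith) (by nlinarith)
  nlinarith [mul_lt_mul_of_pos_left hdiv hc0]

/-- On the punctured interval `0 < |σ| < π / 2`, the angle `σ` and `sin (2 * σ)` have the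
same sign. -/
lemma div_sin_two_mul_pos {σ : ℝ} (hσ0 : 0 < |σ|) (hσ : |σ| < π / 2) :
    0 < σ / Real.sin (2 * σ) := by
  obtain ⟨hl, hu⟩ := abs_lt.mp hσ
  rcases lt_or_gt_of_ne (abs_pos.mp hσ0) with hneg | hpos
  · exact div_pos_of_neg_of_neg hneg
      (Real.sin_neg_of_neg_of_neg_pi_lt (by linarith) (by linarith))
  · exact div_pos hpos (Real.sin_pos_of_pos_of_lt_pi (by linarith) (by linarith))

/-- The Lyapunov derivative of `σ²/2` along the lead-angle dynamics is negative for
`0 < |σ| < π/2`. -/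
theorem lead_angle_lyapunov_negative
    (V r κ : ℝ) (hV : 0 < V) (hr : 0 < r) (hκ : 2 < κ)
    (σ : ℝ) (hσ0 : 0 < |σ|) (hσ : |σ| < π / 2) :
    σ * (-(V * κ / (r * Real.sin (2 * σ))) *
      (1 - Real.cos σ * (1 + Real.sin σ ^ 2 / κ))) < 0 := by
  have hcos0 : 0 < Real.cos σ := Real.cos_pos_of_mem_Ioo (abs_lt.mp hσ)
  have hcos1 : Real.cos σ < 1 := by
    rw [← Real.cos_abs, ← Real.cos_zero]
    exact Real.cos_lt_cos_of_nonneg_of_le_pi_div_two le_rfl hσ.le hσ0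
  have hbracket := one_sub_mul_one_add_div_pos hcos0 hcos1 hκ
  have hgain : 0 < V * κ / r := div_pos (mul_pos hV (by linarith)) hr
  have hprod := mul_pos (mul_pos hgain (div_sin_two_mul_pos hσ0 hσ)) hbracket
  rw [Real.sin_sq, ← div_div]
  calc _ = -(V * κ / r * (σ / Real.sin (2 * σ)) *
        (1 - Real.cos σ * (1 + (1 - Real.cos σ ^ 2) / κ))) := by ring
    _ < 0 := neg_neg_of_pos hprod
end

section
/- Let V > 0 and κ ≠ 0 be real constants, let r, σ, a : ℝ → ℝ, and fix t ∈ ℝ with r(t) > 0. Suppose r has derivative -V·cos(σ(t)) at t and σ has derivative a(t)/V + V·sin(σ(t))/r(t) at t. Then the function s ↦ (r(s)/V)·(1 + sin²(σ(s))/κ) has derivative at t equal to -cos(σ(t))·(1 - sin²(σ(t))/κ) + (r(t)·sin(2σ(t))/(κ·V²))·a(t). -/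
open Real

/-- Derivative of the time-to-go estimate `t_go = (r/V)(1 + sin²σ/κ)` along the
engagement kinematics. -/
theorem time_to_go_derivative
    (V κ : ℝ) (hV : 0 < V) (hκ : κ ≠ 0)
    (r σ a : ℝ → ℝ) (t : ℝ) (hrt : 0 < r t)
    (hr : HasDerivAt r (-V * Real.cos (σ t)) t)
    (hσ : HasDerivAt σ (a t / V + V * Real.sin (σ t) / r t) t) :
    HasDerivAt (fun s => (r s / V) * (1 + Real.sin (σ s) ^ 2 / κ))
      (-Real.cos (σ t) * (1 - Real.sin (σ t) ^ 2 / κ) +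
        (r t * Real.sin (2 * σ t) / (κ * V ^ 2)) * a t) t := by
  have hsq := ((hσ.sin.pow 2).div_const κ).const_add 1
  refine ((hr.div_const V).mul hsq).congr_deriv ?_
  have hV' := hV.ne'
  have hr' := hrt.ne'
  simp only [Pi.pow_apply, Real.sin_two_mul]
  field_simp
  ring
end

section
/- Let p be a positive natural number, κ > 0 and V₀ ≥ 0 real constants, and let ϱ, ϱ₁, ϱ₂ : ℝ → ℝ with ϱ₁(t) > 0 and ϱ₂(t) < 0 for all t ≥ 0. Define ϱ̄(t) = ϱ(t)/ϱ₁(t) if ϱ(t) > 0 and ϱ̄(t) = ϱ(t)/ϱ₂(t) if ϱ(t) ≤ 0, and suppose |ϱ̄(t)| < 1 and (1/(2p))·log(1/(1 - ϱ̄(t)^{2p})) ≤ V₀·exp(-2κt) for all t ≥ 0. Then for all t ≥ 0, ϱ₂(t)·B(t) ≤ ϱ(t) ≤ ϱ₁(t)·B(t), where B(t) = (1 - exp(-2p·V₀·exp(-2κt)))^{1/(2p)}. -/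
/-- A bound on the logarithmic barrier function of `x` confines `|x|`. -/
theorem abs_le_of_log_barrier_le {p : ℕ} (hp : 0 < p) {x V : ℝ} (hx : |x| < 1)
    (hV : (1 / (2 * (p:ℝ))) * Real.log (1 / (1 - x ^ (2 * p))) ≤ V) :
    |x| ≤ (1 - Real.exp (-2 * (p:ℝ) * V)) ^ ((1:ℝ) / (2 * p)) := by
  have hp' : (0:ℝ) < 2 * p := by positivity
  have hpow : |x| ^ (2 * p) = x ^ (2 * p) := (even_two_mul p).pow_abs x
  have hlt : x ^ (2 * p) < 1 := hpow ▸ pow_lt_one₀ (abs_nonneg x) hx (by omega)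
  have hexp : Real.exp (-2 * (p:ℝ) * V) ≤ 1 - x ^ (2 * p) := by
    rw [← Real.le_log_iff_exp_le (sub_pos.2 hlt)]
    rw [one_div (1 - _), Real.log_inv, one_div_mul_eq_div, div_le_iff₀ hp'] at hV
    linarith
  calc |x| = (|x| ^ (2 * p)) ^ ((1:ℝ) / (2 * p)) := by
        have := Real.pow_rpow_inv_natCast (abs_nonneg x) (n := 2 * p) (by omega)
        push_cast at this
        rw [one_div, this]
    _ ≤ _ := by
        rw [hpow]
        exact Real.rpow_le_rpow (hpow ▸ by positivity) (by linarith) (by positivity)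

/-- Exponential decay of the asymmetric barrier Lyapunov function yields time-varying
bounds on the impact-time error. -/
theorem impact_time_error_envelope
    (p : ℕ) (hp : 0 < p) (κ V₀ : ℝ) (hκ : 0 < κ) (hV₀ : 0 ≤ V₀)
    (ϱ ϱ₁ ϱ₂ ϱbar : ℝ → ℝ)
    (h1 : ∀ t ≥ (0:ℝ), 0 < ϱ₁ t) (h2 : ∀ t ≥ (0:ℝ), ϱ₂ t < 0)
    (hbar : ∀ t : ℝ, ϱbar t = if 0 < ϱ t then ϱ t / ϱ₁ t else ϱ t / ϱ₂ t)
    (hlt : ∀ t ≥ (0:ℝ), |ϱbar t| < 1)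
    (hV : ∀ t ≥ (0:ℝ), (1 / (2 * (p:ℝ))) * Real.log (1 / (1 - ϱbar t ^ (2 * p))) ≤
      V₀ * Real.exp (-2 * κ * t)) :
    ∀ t ≥ (0:ℝ),
      ϱ₂ t * (1 - Real.exp (-2 * (p:ℝ) * (V₀ * Real.exp (-2 * κ * t)))) ^ ((1:ℝ) / (2 * p))
        ≤ ϱ t ∧
      ϱ t ≤
      ϱ₁ t * (1 - Real.exp (-2 * (p:ℝ) * (V₀ * Real.exp (-2 * κ * t)))) ^ ((1:ℝ) / (2 * p)) := by
  intro t ht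
  have hle := abs_le_of_log_barrier_le hp (hlt t ht) (hV t ht)
  have hbt := hbar t
  set B := (1 - Real.exp (-2 * (p:ℝ) * (V₀ * Real.exp (-2 * κ * t)))) ^ ((1:ℝ) / (2 * p))
  have hB : 0 ≤ B := (abs_nonneg _).trans hle
  have hb := (le_abs_self _).trans hle
  have h1t := h1 t ht
  have h2t := h2 t ht
  have hupper : 0 ≤ ϱ₁ t * B := mul_nonneg h1t.le hB
  have hlower : ϱ₂ t * B ≤ 0 := mul_nonpos_of_nonpos_of_nonneg h2t.le hB
  split_ifs at hbt with hpos
  · rw [hbt, div_le_iff₀ h1t] at hb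
    constructor <;> linarith
  · rw [hbt, div_le_iff_of_neg h2t] at hb
    constructor <;> linarith
end

section
/- Let c > 0 be a real constant and let V : ℝ → ℝ be differentiable with V(t) ≥ 0 for all t ≥ 0 and V'(t) ≤ -c·√(2·V(t)) for all t ≥ 0. Then V(t) = 0 for all t ≥ √(2·V(0))/c. -/
/-- Finite-time reaching: if `V ≥ 0` and `V' ≤ -c·√(2V)`, then `V` vanishes after
time `√(2·V 0)/c`. -/
theorem finite_time_reaching
    (c : ℝ) (hc : 0 < c) (V : ℝ → ℝ) (hV : Differentiable ℝ V)
    (hV0 : ∀ t ≥ (0:ℝ), 0 ≤ V t)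
    (hV' : ∀ t ≥ (0:ℝ), deriv V t ≤ -c * Real.sqrt (2 * V t)) :
    ∀ t ≥ Real.sqrt (2 * V 0) / c, V t = 0 := by
  intro t ht
  have ht0 : 0 ≤ t := le_trans (by positivity) ht
  by_contra hne
  have hVt : 0 < V t := lt_of_le_of_ne (hV0 t ht0) (Ne.symm hne)
  have hanti : AntitoneOn V (Set.Ici 0) := by
    refine antitoneOn_of_deriv_nonpos (convex_Ici 0) hV.continuous.continuousOn
      hV.differentiableOn fun s hs => ?_
    have hs0 : 0 ≤ s := interior_subset hs
    have := mul_nonneg hc.le (Real.sqrt_nonneg (2 * V s))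
    linarith [hV' s hs0]
  have hpos : ∀ s ∈ Set.Icc 0 t, 0 < 2 * V s := fun s hs => by
    linarith [hanti (Set.mem_Ici.2 hs.1) (Set.mem_Ici.2 ht0) hs.2]
  have hderiv : ∀ s ∈ Set.Icc 0 t, HasDerivAt (fun s => √(2 * V s) + c * s)
      (2 * deriv V s / (2 * √(2 * V s)) + c * 1) s := fun s hs =>
    (((hV s).hasDerivAt.const_mul 2).sqrt (hpos s hs).ne').add ((hasDerivAt_id s).const_mul c)
  have hW : AntitoneOn (fun s => √(2 * V s) + c * s) (Set.Icc 0 t) := by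
    refine antitoneOn_of_deriv_nonpos (convex_Icc 0 t)
      (fun s hs => (hderiv s hs).continuousAt.continuousWithinAt)
      (fun s hs => (hderiv s (interior_subset hs)).differentiableAt.differentiableWithinAt)
      fun s hs => ?_
    have hs' := interior_subset hs
    have hsqrt := Real.sqrt_pos.2 (hpos s hs')
    rw [(hderiv s hs').deriv, mul_div_mul_left _ _ two_ne_zero]
    have : deriv V s / √(2 * V s) ≤ -c := (div_le_iff₀ hsqrt).2 (hV' s hs'.1)
    linarith
  have hle := hW (Set.left_mem_Icc.2 ht0) (Set.right_mem_Icc.2 ht0) ht0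
  have hct := (div_le_iff₀ hc).1 ht
  have hsqrt := Real.sqrt_pos.2 (hpos t (Set.right_mem_Icc.2 ht0))
  simp only [mul_zero, add_zero] at hle
  linarith
end
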